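/- Let n ≥ 3 be an integer, ε > 0 and a ∈ ℝ^{n-1}. Then the standard bubble attains equality in the sharp Euclidean Sobolev trace inequality: (∫_{ℝ^{n-1}} U_{ε,a}(ȳ, 0)^{2(n-1)/(n-2)} dȳ)^{(n-2)/(n-1)} = K_n² ∫_{{y ∈ ℝ^n : y_n > 0}} |∇U_{ε,a}(y)|² dy. -/

import Mathlib

open MeasureTheory Real

/-- The last coordinate `y_n` of a point `y ∈ ℝ^n`. -/
noncomputable def lastCoord (n : ℕ) (y : EuclideanSpace ℝ (Fin n)) : ℝ :=
  if h : 0 < n then y ⟨n - 1, Nat.sub_lt h one_pos⟩ else 0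

/-- The embedding `ℝ^{n-1} × ℝ → ℝ^n`, `(x, t) ↦ (x, t)`. -/
noncomputable def emb (n : ℕ) (x : EuclideanSpace ℝ (Fin (n - 1))) (t : ℝ) :
    EuclideanSpace ℝ (Fin n) :=
  (EuclideanSpace.equiv (Fin n) ℝ).symm
    (fun i => if h : (i : ℕ) < n - 1 then x ⟨i, h⟩ else t)

/-- The area `σ_{n-1}` of the unit `(n-1)`-sphere in `ℝ^n`. -/
noncomputable def sphereArea (n : ℕ) : ℝ :=
  n * (volume (Metric.ball (0 : EuclideanSpace ℝ (Fin n)) 1)).toReal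

/-- The sharp Sobolev trace constant `K_n`. -/
noncomputable def Kconst (n : ℕ) : ℝ :=
  (((n : ℝ) - 2) / 2) ^ (-(1 : ℝ) / 2) * sphereArea n ^ (-(1 : ℝ) / (2 * ((n : ℝ) - 1)))

/-- The standard bubble `U_{ε,a}`. -/
noncomputable def bubble (n : ℕ) (ε : ℝ) (a : EuclideanSpace ℝ (Fin (n - 1)))
    (y : EuclideanSpace ℝ (Fin n)) : ℝ :=
  (ε / ((lastCoord n y + ε / ((n : ℝ) - 2)) ^ 2 +
      ∑ i : Fin (n - 1), (y (Fin.castLE (Nat.sub_le n 1) i) - a i) ^ 2)) ^ (((n : ℝ) - 2) / 2)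

/-- The Euclidean Laplacian `Δu(y) = ∑ ∂²u/∂y_i²(y)`. -/
noncomputable def lap (n : ℕ) (u : EuclideanSpace ℝ (Fin n) → ℝ)
    (y : EuclideanSpace ℝ (Fin n)) : ℝ :=
  ∑ i : Fin n, iteratedDeriv 2 (fun t : ℝ => u (y + t • EuclideanSpace.single i (1 : ℝ))) 0


theorem integrable_exp_neg_mul_sq_norm {V : Type*} [NormedAddCommGroup V] [InnerProductSpace ℝ V]
    [FiniteDimensional ℝ V] [MeasurableSpace V] [BorelSpace V] {b : ℝ} (hb : 0 < b) :
    Integrable (fun v : V => exp (-b * ‖v‖ ^ 2)) :=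
  .of_integral_ne_zero (by
    rw [GaussianFourier.integral_rexp_neg_mul_sq_norm hb]
    positivity)

/-- Integrating `s ^ (m - 1) * exp (-s (c² + ‖v‖²))` over `V` leaves a Gamma integrand in `s`. -/
theorem integral_rpow_mul_exp_neg_mul_add_sq_norm {V : Type*} [NormedAddCommGroup V]
    [InnerProductSpace ℝ V] [FiniteDimensional ℝ V] [MeasurableSpace V] [BorelSpace V]
    (m c : ℝ) {s : ℝ} (hs : 0 < s) :
    ∫ v : V, s ^ (m - 1) * exp (-((c ^ 2 + ‖v‖ ^ 2) * s)) =
      π ^ (Module.finrank ℝ V / 2 : ℝ) *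
        (s ^ (m - Module.finrank ℝ V / 2 - 1) * exp (-(c ^ 2 * s))) := by
  have h (v : V) : s ^ (m - 1) * exp (-((c ^ 2 + ‖v‖ ^ 2) * s)) =
      s ^ (m - 1) * exp (-(c ^ 2 * s)) * exp (-s * ‖v‖ ^ 2) := by
    rw [mul_assoc, ← exp_add]
    ring_nf
  simp_rw [h]
  rw [integral_const_mul, GaussianFourier.integral_rexp_neg_mul_sq_norm hs,
    div_rpow pi_pos.le hs.le, show m - (Module.finrank ℝ V : ℝ) / 2 - 1 =
      m - 1 - Module.finrank ℝ V / 2 by ring, rpow_sub hs (m - 1)]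
  ring

theorem integrable_rpow_mul_exp_neg_mul_add_sq_norm_prod {V : Type*} [NormedAddCommGroup V]
    [InnerProductSpace ℝ V] [FiniteDimensional ℝ V] [MeasurableSpace V] [BorelSpace V]
    {m c : ℝ} (hm : (Module.finrank ℝ V / 2 : ℝ) < m) (hc : 0 < c) :
    Integrable (fun p : V × ℝ => p.2 ^ (m - 1) * exp (-((c ^ 2 + ‖p.1‖ ^ 2) * p.2)))
      ((volume : Measure V).prod (volume.restrict (Set.Ioi (0 : ℝ)))) := by
  rw [integrable_prod_iff' (Measurable.aestronglyMeasurable (by fun_prop))]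
  constructor
  · filter_upwards [ae_restrict_mem measurableSet_Ioi] with s hs
    have h (v : V) : s ^ (m - 1) * exp (-((c ^ 2 + ‖v‖ ^ 2) * s)) =
        s ^ (m - 1) * exp (-(c ^ 2 * s)) * exp (-s * ‖v‖ ^ 2) := by
      rw [mul_assoc, ← exp_add]
      ring_nf
    simp_rw [h]
    exact (integrable_exp_neg_mul_sq_norm hs).const_mul _
  · have hI : IntegrableOn (fun s : ℝ => π ^ (Module.finrank ℝ V / 2 : ℝ) *
        (s ^ (m - Module.finrank ℝ V / 2 - 1) * exp (-(c ^ 2 * s)))) (Set.Ioi 0) := by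
      refine Integrable.const_mul (.of_integral_ne_zero ?_) _
      rw [integral_rpow_mul_exp_neg_mul_Ioi (by linarith) (by positivity)]
      have := Gamma_pos_of_pos (sub_pos.2 hm)
      positivity
    refine hI.congr_fun (fun s hs => ?_) measurableSet_Ioi
    have hs' : (0 : ℝ) < s := hs
    beta_reduce
    rw [← integral_rpow_mul_exp_neg_mul_add_sq_norm m c hs']
    refine integral_congr_ae (.of_forall fun v => ?_)
    simp only [norm_eq_abs]
    rw [abs_of_nonneg (by positivity)]

theorem integral_add_sq_norm_rpow_neg {V : Type*} [NormedAddCommGroup V]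
    [InnerProductSpace ℝ V] [FiniteDimensional ℝ V] [MeasurableSpace V] [BorelSpace V]
    {m c : ℝ} (hm : (Module.finrank ℝ V / 2 : ℝ) < m) (hc : 0 < c) :
    ∫ v : V, (c ^ 2 + ‖v‖ ^ 2) ^ (-m) =
      π ^ (Module.finrank ℝ V / 2 : ℝ) * Gamma (m - Module.finrank ℝ V / 2) / Gamma m *
        c ^ (Module.finrank ℝ V - 2 * m) := by
  have hm0 : 0 < m := lt_of_le_of_lt (by positivity) hm
  have hΓ := Gamma_pos_of_pos hm0
  have h1 : ∫ v : V, ∫ s in Set.Ioi (0 : ℝ), s ^ (m - 1) * exp (-((c ^ 2 + ‖v‖ ^ 2) * s)) =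
      (∫ v : V, (c ^ 2 + ‖v‖ ^ 2) ^ (-m)) * Gamma m := by
    rw [← integral_mul_const]
    refine integral_congr_ae (.of_forall fun v => ?_)
    have : 0 < c ^ 2 + ‖v‖ ^ 2 := by positivity
    simp only
    rw [integral_rpow_mul_exp_neg_mul_Ioi hm0 this, one_div, inv_rpow this.le, rpow_neg this.le]
  have h2 : ∫ v : V, ∫ s in Set.Ioi (0 : ℝ), s ^ (m - 1) * exp (-((c ^ 2 + ‖v‖ ^ 2) * s)) =
      π ^ (Module.finrank ℝ V / 2 : ℝ) * (c ^ (Module.finrank ℝ V - 2 * m) *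
        Gamma (m - Module.finrank ℝ V / 2)) := by
    rw [integral_integral_swap (integrable_rpow_mul_exp_neg_mul_add_sq_norm_prod hm hc),
      setIntegral_congr_fun measurableSet_Ioi
        (fun s hs => integral_rpow_mul_exp_neg_mul_add_sq_norm m c hs), integral_const_mul,
      integral_rpow_mul_exp_neg_mul_Ioi (by linarith) (by positivity), one_div,
      ← rpow_natCast, ← rpow_neg hc.le, ← rpow_mul hc.le]
    congr 3
    push_cast
    ring
  rw [h1] at h2
  rw [div_mul_eq_mul_div, eq_div_iff hΓ.ne', h2]
  ring

theorem integrable_add_sq_norm_rpow_neg {V : Type*} [NormedAddCommGroup V]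
    [InnerProductSpace ℝ V] [FiniteDimensional ℝ V] [MeasurableSpace V] [BorelSpace V]
    {m c : ℝ} (hm : (Module.finrank ℝ V / 2 : ℝ) < m) (hc : 0 < c) :
    Integrable (fun v : V => (c ^ 2 + ‖v‖ ^ 2) ^ (-m)) := by
  refine .of_integral_ne_zero ?_
  rw [integral_add_sq_norm_rpow_neg hm hc]
  have h1 := Gamma_pos_of_pos (sub_pos.2 hm)
  have h2 := Gamma_pos_of_pos (lt_of_le_of_lt (by positivity) hm)
  positivity

/-- The constant of `integral_add_sq_norm_rpow_neg` in the conformal case, where stereographic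
projection compares it with the area of the sphere. -/
theorem pi_rpow_mul_Gamma_div_Gamma_eq_sphereArea {m : ℕ} (hm : 0 < m) :
    π ^ (m / 2 : ℝ) * Gamma (m / 2) / Gamma m = sphereArea (m + 1) / 2 ^ m := by
  have hm' : (0 : ℝ) < m := by exact_mod_cast hm
  have h := Gamma_mul_Gamma_add_half (m / 2 : ℝ)
  have h1 : Gamma (((m + 1 : ℕ) : ℝ) / 2 + 1) = ((m : ℝ) + 1) / 2 * Gamma (m / 2 + 1 / 2) := by
    rw [← add_div, ← Gamma_add_one (by positivity)]
    push_cast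
    rfl
  have hA := Gamma_pos_of_pos (show (0 : ℝ) < m / 2 + 1 / 2 by positivity)
  have hB := Gamma_pos_of_pos hm'
  rw [show 2 * ((m : ℝ) / 2) = m by ring, rpow_sub two_pos, rpow_one, rpow_natCast] at h
  have hp : √π ^ (m + 1) = π ^ (m / 2 : ℝ) * √π := by
    rw [pow_succ, sqrt_eq_rpow, ← rpow_natCast, ← rpow_mul pi_pos.le]
    ring_nf
  rw [sphereArea, EuclideanSpace.volume_ball, Fintype.card_fin, ENNReal.ofReal_one, one_pow,
    one_mul, h1, ENNReal.toReal_ofReal (by positivity), hp]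
  push_cast
  field_simp
  field_simp at h
  linear_combination h

theorem integral_add_sq_norm_sub_rpow_neg {m : ℕ} (hm : 0 < m) {c : ℝ} (hc : 0 < c)
    (a : EuclideanSpace ℝ (Fin m)) :
    ∫ x : EuclideanSpace ℝ (Fin m), (c ^ 2 + ‖x - a‖ ^ 2) ^ (-(m : ℝ)) =
      sphereArea (m + 1) / 2 ^ m * c ^ (-(m : ℝ)) := by
  have hm' : (0 : ℝ) < m := by exact_mod_cast hm
  rw [integral_sub_right_eq_self (fun x : EuclideanSpace ℝ (Fin m) =>
      (c ^ 2 + ‖x‖ ^ 2) ^ (-(m : ℝ))) a, integral_add_sq_norm_rpow_neg (by simpa using hm) hc,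
    finrank_euclideanSpace_fin, sub_half, pi_rpow_mul_Gamma_div_Gamma_eq_sphereArea hm]
  congr 2
  ring

theorem integrable_add_sq_norm_sub_rpow_neg {m : ℕ} (hm : 0 < m) {c : ℝ} (hc : 0 < c)
    (a : EuclideanSpace ℝ (Fin m)) :
    Integrable (fun x : EuclideanSpace ℝ (Fin m) => (c ^ 2 + ‖x - a‖ ^ 2) ^ (-(m : ℝ))) := by
  have hm' : (0 : ℝ) < m := by exact_mod_cast hm
  exact (integrable_add_sq_norm_rpow_neg (V := EuclideanSpace ℝ (Fin m)) (m := m)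
    (by simpa using hm) hc).comp_sub_right a

theorem setIntegral_Ioi_zero_prod_add_sq_norm_sub_rpow_neg {m : ℕ} (hm : 2 ≤ m) {δ : ℝ}
    (hδ : 0 < δ) (a : EuclideanSpace ℝ (Fin m)) :
    ∫ p in Set.Ioi (0 : ℝ) ×ˢ (Set.univ : Set (EuclideanSpace ℝ (Fin m))),
        ((p.1 + δ) ^ 2 + ‖p.2 - a‖ ^ 2) ^ (-(m : ℝ)) =
      sphereArea (m + 1) / 2 ^ m * (δ ^ (1 - (m : ℝ)) / (m - 1)) := by
  have hm0 : 0 < m := by lia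
  have hm2 : (2 : ℝ) ≤ m := by exact_mod_cast hm
  have hint : Integrable (fun p : ℝ × EuclideanSpace ℝ (Fin m) =>
      ((p.1 + δ) ^ 2 + ‖p.2 - a‖ ^ 2) ^ (-(m : ℝ)))
      ((volume.restrict (Set.Ioi (0 : ℝ))).prod (volume.restrict Set.univ)) := by
    rw [Measure.restrict_univ, integrable_prod_iff (Measurable.aestronglyMeasurable (by fun_prop))]
    constructor
    · filter_upwards [ae_restrict_mem measurableSet_Ioi] with t ht
      exact integrable_add_sq_norm_sub_rpow_neg hm0 (add_pos ht hδ) a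
    · refine IntegrableOn.congr_fun ((integrableOn_add_rpow_Ioi_of_lt (a := -(m : ℝ)) (c := 0)
        (m := δ) (by linarith) (by linarith)).const_mul (sphereArea (m + 1) / 2 ^ m))
        (fun t ht => ?_) measurableSet_Ioi
      beta_reduce
      rw [← integral_add_sq_norm_sub_rpow_neg hm0 (add_pos ht hδ) a]
      refine integral_congr_ae (.of_forall fun v => ?_)
      simp only [norm_eq_abs]
      rw [abs_of_nonneg (by positivity)]
  have hshift : ∫ t in Set.Ioi (0 : ℝ), (t + δ) ^ (-(m : ℝ)) =
      ∫ t in Set.Ioi δ, t ^ (-(m : ℝ)) := by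
    simpa using (measurePreserving_add_right volume δ).setIntegral_preimage_emb
      (measurableEmbedding_addRight δ) (fun t : ℝ => t ^ (-(m : ℝ))) (Set.Ioi δ)
  rw [Measure.volume_eq_prod, ← Measure.prod_restrict, integral_prod _ hint,
    setIntegral_congr_fun measurableSet_Ioi (g := fun t : ℝ =>
      sphereArea (m + 1) / 2 ^ m * (t + δ) ^ (-(m : ℝ))) (fun t ht => by
        beta_reduce
        rw [setIntegral_univ, integral_add_sq_norm_sub_rpow_neg hm0 (add_pos ht hδ) a]),
    integral_const_mul, hshift,
    integral_Ioi_rpow_of_lt (by linarith) hδ, show -(m : ℝ) + 1 = -(m - 1) by ring, neg_div_neg_eq,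
    neg_sub]

/-- The measurable equivalence `ℝ^{m+1} ≃ ℝ × ℝ^m`, `y ↦ (y_{m+1}, ȳ)`. -/
noncomputable def splitLast (m : ℕ) :
    EuclideanSpace ℝ (Fin (m + 1)) ≃ᵐ ℝ × EuclideanSpace ℝ (Fin m) :=
  (MeasurableEquiv.toLp 2 (Fin (m + 1) → ℝ)).symm.trans
    ((MeasurableEquiv.piFinSuccAbove (fun _ => ℝ) (Fin.last m)).trans
      ((MeasurableEquiv.refl ℝ).prodCongr (MeasurableEquiv.toLp 2 (Fin m → ℝ))))

theorem measurePreserving_splitLast (m : ℕ) : MeasurePreserving (splitLast m) :=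
  (PiLp.volume_preserving_ofLp (Fin (m + 1))).trans
    ((volume_preserving_piFinSuccAbove (fun _ => ℝ) (Fin.last m)).trans
      ((MeasurePreserving.id volume).prod (PiLp.volume_preserving_toLp (Fin m))))

theorem splitLast_fst {m : ℕ} (y : EuclideanSpace ℝ (Fin (m + 1))) :
    (splitLast m y).1 = lastCoord (m + 1) y := by
  rw [lastCoord, dif_pos m.succ_pos]
  rfl

theorem splitLast_snd_apply {m : ℕ} (y : EuclideanSpace ℝ (Fin (m + 1))) (i : Fin m) :
    (splitLast m y).2 i = y i.castSucc := by
  rw [← Fin.succAbove_last_apply]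
  rfl

theorem emb_castSucc {m : ℕ} (x : EuclideanSpace ℝ (Fin m)) (t : ℝ) (i : Fin m) :
    emb (m + 1) x t i.castSucc = x i := by
  simp [emb]

theorem lastCoord_emb {m : ℕ} (x : EuclideanSpace ℝ (Fin m)) (t : ℝ) :
    lastCoord (m + 1) (emb (m + 1) x t) = t := by
  simp [emb, lastCoord]

theorem bubble_apply {m : ℕ} (ε : ℝ) (a : EuclideanSpace ℝ (Fin m))
    (y : EuclideanSpace ℝ (Fin (m + 1))) :
    bubble (m + 1) ε a y = (ε / ((lastCoord (m + 1) y + ε / ((m : ℝ) - 1)) ^ 2 +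
      ‖(splitLast m y).2 - a‖ ^ 2)) ^ (((m : ℝ) - 1) / 2) := by
  rw [EuclideanSpace.real_norm_sq_eq, bubble,
    show ((m + 1 : ℕ) : ℝ) - 2 = m - 1 by push_cast; ring]
  simp only [PiLp.sub_apply, splitLast_snd_apply]
  rfl

theorem norm_sub_emb_sq {m : ℕ} (y : EuclideanSpace ℝ (Fin (m + 1)))
    (a : EuclideanSpace ℝ (Fin m)) (t : ℝ) :
    ‖y - emb (m + 1) a t‖ ^ 2 =
      (lastCoord (m + 1) y - t) ^ 2 + ‖(splitLast m y).2 - a‖ ^ 2 := by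
  have h (z : EuclideanSpace ℝ (Fin (m + 1))) : z (Fin.last m) = lastCoord (m + 1) z :=
    splitLast_fst z
  simp only [EuclideanSpace.real_norm_sq_eq, Fin.sum_univ_castSucc, PiLp.sub_apply,
    splitLast_snd_apply, emb_castSucc, h, lastCoord_emb]
  ring

theorem bubble_eq_norm_sub {m : ℕ} (ε : ℝ) (a : EuclideanSpace ℝ (Fin m)) :
    bubble (m + 1) ε a = fun y =>
      (ε / ‖y - emb (m + 1) a (-(ε / ((m : ℝ) - 1)))‖ ^ 2) ^ (((m : ℝ) - 1) / 2) := by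
  ext y
  rw [bubble_apply, norm_sub_emb_sq, sub_neg_eq_add]

theorem hasGradientAt_div_norm_sub_sq_rpow {V : Type*} [NormedAddCommGroup V]
    [InnerProductSpace ℝ V] [CompleteSpace V] {ε : ℝ} (hε : 0 < ε) (p : ℝ) {y b : V}
    (hy : y ≠ b) :
    HasGradientAt (fun y => (ε / ‖y - b‖ ^ 2) ^ p)
      ((-2 * p * (ε / ‖y - b‖ ^ 2) ^ p / ‖y - b‖ ^ 2) • (y - b)) y := by
  have hr : 0 < ‖y - b‖ := norm_pos_iff.2 (sub_ne_zero.2 hy)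
  have hn : HasFDerivAt (fun y : V => ‖y - b‖ ^ 2) (2 • innerSL ℝ (y - b)) y := by
    simpa using ((hasFDerivAt_id y).sub_const b).norm_sq
  have hg : HasDerivAt (fun r : ℝ => (ε / r) ^ p)
      (-p * (ε / ‖y - b‖ ^ 2) ^ p / ‖y - b‖ ^ 2) (‖y - b‖ ^ 2) := by
    have h := ((hasDerivAt_inv (pow_pos hr 2).ne').const_mul ε).rpow_const (p := p)
      (Or.inl (by positivity))
    simp only [← div_eq_mul_inv] at h
    convert h using 1
    rw [rpow_sub_one (by positivity)]
    field_simp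
  rw [hasGradientAt_iff_hasFDerivAt]
  refine (hg.comp_hasFDerivAt y hn).congr_fderiv ?_
  ext v
  simp
  ring

theorem norm_gradient_div_norm_sub_sq_rpow_sq {V : Type*} [NormedAddCommGroup V]
    [InnerProductSpace ℝ V] [CompleteSpace V] {ε : ℝ} (hε : 0 < ε) (p : ℝ) {y b : V}
    (hy : y ≠ b) :
    ‖gradient (fun y => (ε / ‖y - b‖ ^ 2) ^ p) y‖ ^ 2 =
      4 * p ^ 2 * ε ^ (2 * p) * (‖y - b‖ ^ 2) ^ (-(2 * p + 1)) := by
  have hr : 0 < ‖y - b‖ := norm_pos_iff.2 (sub_ne_zero.2 hy)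
  rw [(hasGradientAt_div_norm_sub_sq_rpow hε p hy).gradient, norm_smul, mul_pow, norm_eq_abs,
    sq_abs, div_rpow hε.le (by positivity), rpow_neg (by positivity), rpow_add_one (by positivity),
    two_mul, rpow_add hε, rpow_add (by positivity)]
  field_simp
  ring

theorem setIntegral_norm_gradient_bubble_sq {m : ℕ} (hm : 2 ≤ m) {ε : ℝ} (hε : 0 < ε)
    (a : EuclideanSpace ℝ (Fin m)) :
    ∫ y in {y : EuclideanSpace ℝ (Fin (m + 1)) | 0 < lastCoord (m + 1) y},
        ‖gradient (bubble (m + 1) ε a) y‖ ^ 2 =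
      ((m : ℝ) - 1) ^ m * (sphereArea (m + 1) / 2 ^ m) := by
  have hm1 : (0 : ℝ) < m - 1 := by
    have : (2 : ℝ) ≤ m := by exact_mod_cast hm
    linarith
  have hδ : 0 < ε / ((m : ℝ) - 1) := by positivity
  have hset : {y : EuclideanSpace ℝ (Fin (m + 1)) | 0 < lastCoord (m + 1) y} =
      splitLast m ⁻¹' (Set.Ioi (0 : ℝ) ×ˢ Set.univ) := by
    ext y
    simp [splitLast_fst]
  have hpt : Set.EqOn (fun y => ‖gradient (bubble (m + 1) ε a) y‖ ^ 2)
      (fun y => ((m : ℝ) - 1) ^ 2 * ε ^ ((m : ℝ) - 1) *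
        (((splitLast m y).1 + ε / ((m : ℝ) - 1)) ^ 2 + ‖(splitLast m y).2 - a‖ ^ 2) ^ (-(m : ℝ)))
      (splitLast m ⁻¹' (Set.Ioi (0 : ℝ) ×ˢ Set.univ)) := by
    intro y hy
    have hy0 : 0 < lastCoord (m + 1) y := by simpa [splitLast_fst] using hy
    have hne : y ≠ emb (m + 1) a (-(ε / ((m : ℝ) - 1))) := by
      rintro rfl
      rw [lastCoord_emb] at hy0
      linarith
    beta_reduce
    rw [bubble_eq_norm_sub, norm_gradient_div_norm_sub_sq_rpow_sq hε _ hne, norm_sub_emb_sq,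
      sub_neg_eq_add, splitLast_fst, mul_div_cancel₀ _ two_ne_zero, sub_add_cancel]
    ring
  have hmeas : MeasurableSet (splitLast m ⁻¹'
      (Set.Ioi (0 : ℝ) ×ˢ (Set.univ : Set (EuclideanSpace ℝ (Fin m))))) :=
    (splitLast m).measurable (measurableSet_Ioi.prod MeasurableSet.univ)
  rw [hset, setIntegral_congr_fun hmeas hpt, integral_const_mul,
    (measurePreserving_splitLast m).setIntegral_preimage_emb (splitLast m).measurableEmbedding
      (fun p => ((p.1 + ε / ((m : ℝ) - 1)) ^ 2 + ‖p.2 - a‖ ^ 2) ^ (-(m : ℝ))),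
    setIntegral_Ioi_zero_prod_add_sq_norm_sub_rpow_neg hm hδ, div_rpow hε.le hm1.le,
    show 1 - (m : ℝ) = -(m - 1) by ring, rpow_neg hε.le, rpow_neg hm1.le, rpow_sub_one hm1.ne',
    rpow_natCast]
  have := rpow_pos_of_pos hε ((m : ℝ) - 1)
  field_simp

theorem integral_bubble_emb_zero_rpow {m : ℕ} (hm : 2 ≤ m) {ε : ℝ} (hε : 0 < ε)
    (a : EuclideanSpace ℝ (Fin m)) :
    ∫ x : EuclideanSpace ℝ (Fin m),
        bubble (m + 1) ε a (emb (m + 1) x 0) ^ (2 * (m : ℝ) / ((m : ℝ) - 1)) =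
      ((m : ℝ) - 1) ^ m * (sphereArea (m + 1) / 2 ^ m) := by
  have hm1 : (0 : ℝ) < m - 1 := by
    have : (2 : ℝ) ≤ m := by exact_mod_cast hm
    linarith
  have hδ : 0 < ε / ((m : ℝ) - 1) := by positivity
  have hpt (x : EuclideanSpace ℝ (Fin m)) :
      bubble (m + 1) ε a (emb (m + 1) x 0) ^ (2 * (m : ℝ) / ((m : ℝ) - 1)) =
        ε ^ m * ((ε / ((m : ℝ) - 1)) ^ 2 + ‖x - a‖ ^ 2) ^ (-(m : ℝ)) := by
    have hx : (splitLast m (emb (m + 1) x 0)).2 = x := by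
      ext i
      rw [splitLast_snd_apply, emb_castSucc]
    have hD : 0 < (ε / ((m : ℝ) - 1)) ^ 2 + ‖x - a‖ ^ 2 := by positivity
    rw [bubble_apply, lastCoord_emb, hx, zero_add, ← rpow_mul (by positivity),
      show ((m : ℝ) - 1) / 2 * (2 * (m : ℝ) / ((m : ℝ) - 1)) = m by field_simp,
      div_rpow hε.le hD.le, rpow_neg hD.le, rpow_natCast ε, div_eq_mul_inv]
  simp_rw [hpt]
  rw [integral_const_mul, integral_add_sq_norm_sub_rpow_neg (by lia) hδ, rpow_neg hδ.le,
    rpow_natCast, div_pow]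
  field_simp

theorem sphereArea_pos {n : ℕ} (hn : 0 < n) : 0 < sphereArea n :=
  mul_pos (by exact_mod_cast hn)
    (ENNReal.toReal_pos (Metric.measure_ball_pos _ _ one_pos).ne' measure_ball_lt_top.ne)

/-- the standard bubble attains equality in the sharp Euclidean Sobolev
trace inequality. -/
theorem bubble_sobolev_equality (n : ℕ) (hn : 3 ≤ n) (ε : ℝ) (hε : 0 < ε)
    (a : EuclideanSpace ℝ (Fin (n - 1))) :
    (∫ x : EuclideanSpace ℝ (Fin (n - 1)),
        bubble n ε a (emb n x 0) ^ (2 * ((n : ℝ) - 1) / ((n : ℝ) - 2)))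
        ^ (((n : ℝ) - 2) / ((n : ℝ) - 1))
      = Kconst n ^ 2 *
        ∫ y in {y : EuclideanSpace ℝ (Fin n) | 0 < lastCoord n y},
          ‖gradient (bubble n ε a) y‖ ^ 2 := by
  obtain ⟨m, rfl⟩ : ∃ m, n = m + 1 := ⟨n - 1, by lia⟩
  have hm : 2 ≤ m := by lia
  have hm0 : (0 : ℝ) < m := by
    have : 0 < m := by lia
    exact_mod_cast this
  have hm1 : (0 : ℝ) < m - 1 := by
    have : (2 : ℝ) ≤ m := by exact_mod_cast hm
    linarith
  have hσ : 0 < sphereArea (m + 1) := sphereArea_pos m.succ_pos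
  have h1 : ((m + 1 : ℕ) : ℝ) - 1 = m := by push_cast; ring
  have h2 : ((m + 1 : ℕ) : ℝ) - 2 = m - 1 := by push_cast; ring
  have hK : Kconst (m + 1) ^ 2 =
      (((m : ℝ) - 1) ^ m * (sphereArea (m + 1) / 2 ^ m)) ^ (-(1 / (m : ℝ))) := by
    have hpow : ((m : ℝ) - 1) ^ m * (sphereArea (m + 1) / 2 ^ m) =
        (((m : ℝ) - 1) / 2) ^ (m : ℝ) * sphereArea (m + 1) := by
      rw [rpow_natCast, div_pow]
      ring
    rw [Kconst, h1, h2, hpow, mul_rpow (by positivity) hσ.le, ← rpow_mul (by positivity), mul_pow,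
      ← rpow_natCast, ← rpow_natCast (_ ^ _ : ℝ), ← rpow_mul (by positivity), ← rpow_mul hσ.le]
    congr 2 <;> push_cast <;> field_simp
  rw [setIntegral_norm_gradient_bubble_sq hm hε, hK, h1, h2]
  refine (congrArg (· ^ (((m : ℝ) - 1) / m)) (integral_bubble_emb_zero_rpow hm hε a)).trans ?_
  rw [← rpow_add_one (by positivity)]
  congr 1
  field_simp
  ring
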